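/- Let M be a spacelike surface in ℝ^{3,1} with a canonical normal null direction Z. Then the normal curvature of M is given by K_N = −a β(W). -/

import Mathlib

noncomputable section

/-- Points of the parameter domain of the surface chart. -/
abbrev Pt : Type := ℝ × ℝ

/-- Vectors of the Minkowski space `ℝ^{3,1}`. -/
abbrev E4 : Type := Fin 4 → ℝ

/-- The Minkowski bilinear form of signature `(+,+,+,-)` on `ℝ⁴`. -/
def mink (v w : E4) : ℝ := v 0 * w 0 + v 1 * w 1 + v 2 * w 2 - v 3 * w 3

/-- Realization in `ℝ^{3,1}` of a coordinate vector field `X` along the immersion `ψ`. -/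
def vecF (ψ : Pt → E4) (X : Pt → Pt) : Pt → E4 := fun p => fderiv ℝ ψ p (X p)

/-- Flat (ambient) derivative of an `ℝ⁴`-valued field along a coordinate vector field. -/
def Dflat (X : Pt → Pt) (V : Pt → E4) : Pt → E4 := fun p => fderiv ℝ V p (X p)

/-- Second fundamental form `B(X,Y) = ∇̄_X Y − ∇_X Y`. -/
def sff (ψ : Pt → E4) (conn : (Pt → Pt) → (Pt → Pt) → Pt → Pt) (X Y : Pt → Pt) : Pt → E4 :=
  fun p => Dflat X (vecF ψ Y) p - vecF ψ (conn X Y) p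

/-- `v` is tangent to the surface at `p`. -/
def isTangentV (ψ : Pt → E4) (p : Pt) (v : E4) : Prop := ∃ w : Pt, fderiv ℝ ψ p w = v

/-- `v` is normal to the surface at `p`. -/
def isNormalV (ψ : Pt → E4) (p : Pt) (v : E4) : Prop := ∀ w : Pt, mink v (fderiv ℝ ψ p w) = 0

/-- Lie bracket of coordinate vector fields on the chart. -/
def lieB (X Y : Pt → Pt) : Pt → Pt := fun p => fderiv ℝ Y p (X p) - fderiv ℝ X p (Y p)

/-- Curvature tensor `R(X,Y)V = ∇_Y∇_X V − ∇_X∇_Y V + ∇_{[X,Y]}V`. -/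
def curvR (conn : (Pt → Pt) → (Pt → Pt) → Pt → Pt) (X Y V : Pt → Pt) : Pt → Pt :=
  fun p => conn Y (conn X V) p - conn X (conn Y V) p + conn (lieB X Y) V p

/-- Normal curvature tensor `R^⊥(X,Y)ν = ∇⊥_Y∇⊥_X ν − ∇⊥_X∇⊥_Y ν + ∇⊥_{[X,Y]}ν`. -/
def curvRperp (nconn : (Pt → Pt) → (Pt → E4) → Pt → E4) (X Y : Pt → Pt) (ν : Pt → E4) :
    Pt → E4 :=
  fun p => nconn Y (nconn X ν) p - nconn X (nconn Y ν) p + nconn (lieB X Y) ν p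

/-- Determinant of four vectors of `ℝ⁴` (the volume form `e₁∧e₂∧e₃∧e₄ ↦ 1`). -/
def det4 (a b c d : E4) : ℝ := Matrix.det (Matrix.of ![a, b, c, d])

/-- A spacelike surface in `ℝ^{3,1}`, given by a chart `ψ : U → ℝ^{3,1}`, endowed with a
canonical normal null direction with respect to the constant unit spacelike vector `Z`,
together with all the associated geometric data: the Levi-Civita connection `conn`,
the normal connection `nconn`, the tangent part `Z^⊤` (coordinates `ZT`), the oriented
orthonormal completion `W` (coordinates `Wc`), the shape operator `shA = A_{Z^⊥}`,
the 1-form `β` with `B(X,Z^⊤) = β(X)Z^⊥`, and the lightlike normal field `W'` with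
`⟨Z^⊥,W'⟩ = 1`.  Each piece of data is characterized by its defining property. -/
structure CNND where
  U : Set Pt
  hUopen : IsOpen U
  ψ : Pt → E4
  hψ : ContDiffOn ℝ (⊤ : ℕ∞) ψ U
  himm : ∀ p ∈ U, ∀ v : Pt, fderiv ℝ ψ p v = 0 → v = 0
  hspacelike : ∀ p ∈ U, ∀ v : Pt, v ≠ 0 → 0 < mink (fderiv ℝ ψ p v) (fderiv ℝ ψ p v)
  /-- Levi-Civita connection of the induced metric, as the tangent part of the flat one. -/
  conn : (Pt → Pt) → (Pt → Pt) → Pt → Pt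
  hconn : ∀ X Y, ∀ p ∈ U, DifferentiableAt ℝ (vecF ψ Y) p → isNormalV ψ p (sff ψ conn X Y p)
  hconnSmooth : ∀ X Y, ContDiffOn ℝ (⊤ : ℕ∞) X U → ContDiffOn ℝ (⊤ : ℕ∞) Y U → ContDiffOn ℝ (⊤ : ℕ∞) (conn X Y) U
  /-- Normal connection: the normal part of the flat derivative of a normal field. -/
  nconn : (Pt → Pt) → (Pt → E4) → Pt → E4
  hnconn : ∀ X ν, ∀ p ∈ U, (∀ q ∈ U, isNormalV ψ q (ν q)) → DifferentiableAt ℝ ν p →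
    isNormalV ψ p (nconn X ν p) ∧ isTangentV ψ p (Dflat X ν p - nconn X ν p)
  hnconnSmooth : ∀ X ν, ContDiffOn ℝ (⊤ : ℕ∞) X U → (∀ q ∈ U, isNormalV ψ q (ν q)) →
    ContDiffOn ℝ (⊤ : ℕ∞) ν U → ContDiffOn ℝ (⊤ : ℕ∞) (nconn X ν) U
  /-- The parallel (constant) vector field `Z`, a unit spacelike vector. -/
  Z : E4
  hZunit : mink Z Z = 1
  /-- Coordinates of the tangent part `Z^⊤` of `Z`; `Z^⊥ = Z − Z^⊤` is normal. -/
  ZT : Pt → Pt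
  hZTsmooth : ContDiffOn ℝ (⊤ : ℕ∞) ZT U
  hZTtangentpart : ∀ p ∈ U, isNormalV ψ p (Z - fderiv ℝ ψ p (ZT p))
  /-- canonical normal null direction: `Z^⊥` is lightlike … -/
  hZperpNull : ∀ p ∈ U, mink (Z - fderiv ℝ ψ p (ZT p)) (Z - fderiv ℝ ψ p (ZT p)) = 0
  /-- … and nowhere zero. -/
  hZperpNe : ∀ p ∈ U, Z - fderiv ℝ ψ p (ZT p) ≠ 0
  /-- Coordinates of the unit tangent field `W` orthogonal to `Z^⊤`, positively oriented. -/
  Wc : Pt → Pt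
  hWsmooth : ContDiffOn ℝ (⊤ : ℕ∞) Wc U
  hWunit : ∀ p ∈ U, mink (fderiv ℝ ψ p (Wc p)) (fderiv ℝ ψ p (Wc p)) = 1
  hWorth : ∀ p ∈ U, mink (fderiv ℝ ψ p (ZT p)) (fderiv ℝ ψ p (Wc p)) = 0
  hWorient : ∀ p ∈ U, 0 < (ZT p).1 * (Wc p).2 - (ZT p).2 * (Wc p).1
  /-- The shape operator `A_{Z^⊥}`: `⟨A_{Z^⊥}X, Y⟩ = ⟨B(X,Y), Z^⊥⟩`. -/
  shA : (Pt → Pt) → Pt → Pt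
  hshA : ∀ X Y, ∀ p ∈ U, DifferentiableAt ℝ (vecF ψ Y) p →
    mink (fderiv ℝ ψ p (shA X p)) (fderiv ℝ ψ p (Y p)) =
      mink (sff ψ conn X Y p) (Z - fderiv ℝ ψ p (ZT p))
  /-- The 1-form `β` with `B(X, Z^⊤) = β(X) Z^⊥`. -/
  beta : Pt → Pt → ℝ
  hbeta : ∀ X, ∀ p ∈ U, sff ψ conn X ZT p = beta p (X p) • (Z - fderiv ℝ ψ p (ZT p))
  /-- The lightlike normal field `W'` with `⟨Z^⊥, W'⟩ = 1`, such that
  `(Z^⊤, W, (Z^⊥+W')/√2, (Z^⊥−W')/√2)` is a positively oriented orthonormal frame. -/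
  Wp : Pt → E4
  hWpNormal : ∀ p ∈ U, isNormalV ψ p (Wp p)
  hWpNull : ∀ p ∈ U, mink (Wp p) (Wp p) = 0
  hWpPair : ∀ p ∈ U, mink (Z - fderiv ℝ ψ p (ZT p)) (Wp p) = 1
  hWpOrient : ∀ p ∈ U, 0 < det4 (fderiv ℝ ψ p (ZT p)) (fderiv ℝ ψ p (Wc p))
    ((Real.sqrt 2)⁻¹ • ((Z - fderiv ℝ ψ p (ZT p)) + Wp p))
    ((Real.sqrt 2)⁻¹ • ((Z - fderiv ℝ ψ p (ZT p)) - Wp p))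

namespace CNND

variable (S : CNND)

/-- The normal part `Z^⊥` of `Z` along the surface. -/
def Zperp : Pt → E4 := fun p => S.Z - fderiv ℝ S.ψ p (S.ZT p)

/-- The second fundamental form of the surface. -/
def B : (Pt → Pt) → (Pt → Pt) → Pt → E4 := sff S.ψ S.conn

/-- The function `a = α(W) = ⟨B(W,W), Z^⊥⟩`. -/
def afun : Pt → ℝ := fun p => mink (S.B S.Wc S.Wc p) (S.Zperp p)

/-- The 1-form `α(X) = ⟨B(X,W), Z^⊥⟩`. -/
def alphaF (X : Pt → Pt) : Pt → ℝ := fun p => mink (S.B X S.Wc p) (S.Zperp p)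

/-- The mean curvature vector `H⃗ = (1/2)(B(Z^⊤,Z^⊤) + B(W,W))`. -/
def Hvec : Pt → E4 := fun p => (1 / 2 : ℝ) • (S.B S.ZT S.ZT p + S.B S.Wc S.Wc p)

/-- The Gauss curvature `K = ⟨R(Z^⊤,W)Z^⊤, W⟩`. -/
def Kfun : Pt → ℝ := fun p =>
  mink (fderiv ℝ S.ψ p (curvR S.conn S.ZT S.Wc S.ZT p)) (fderiv ℝ S.ψ p (S.Wc p))

/-- The normal curvature `K_N = ⟨R^⊥(Z^⊤,W)Z^⊥, W'⟩`. -/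
def KNfun : Pt → ℝ := fun p => mink (curvRperp S.nconn S.ZT S.Wc S.Zperp p) (S.Wp p)

end CNND

/-- The wedge `v ∧ w` of two vectors of `ℝ⁴`, as an antisymmetric matrix (bivector). -/
def wedge2 (v w : E4) : Fin 4 → Fin 4 → ℝ := fun i j => v i * w j - v j * w i

/-- The Gauss map `G = Z^⊤ ∧ W : M → Λ²ℝ^{3,1}`. -/
def CNND.Gmap (S : CNND) : Pt → Fin 4 → Fin 4 → ℝ :=
  fun p => wedge2 (fderiv ℝ S.ψ p (S.ZT p)) (fderiv ℝ S.ψ p (S.Wc p))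

/-- The signs of the Minkowski metric. -/
def epsM : Fin 4 → ℝ := fun i => if i = 3 then -1 else 1

/-- The induced (signature `(3,3)`) inner product on bivectors of `ℝ^{3,1}`:
`⟨v∧w, v'∧w'⟩ = ⟨v,v'⟩⟨w,w'⟩ − ⟨v,w'⟩⟨w,v'⟩`. -/
def binner (η η' : Fin 4 → Fin 4 → ℝ) : ℝ :=
  (1 / 2) * ∑ i : Fin 4, ∑ j : Fin 4, epsM i * epsM j * η i j * η' i j

/-- The wedge product `Λ²ℝ^{3,1} × Λ²ℝ^{3,1} → Λ⁴ℝ^{3,1} ≅ ℝ`, normalized so that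
`(v∧w)∧(v'∧w') = det(v,w,v',w')`. -/
def bwedge (η η' : Fin 4 → Fin 4 → ℝ) : ℝ :=
  (1 / 4) * ∑ σ : Equiv.Perm (Fin 4),
    ((Equiv.Perm.sign σ : ℤ) : ℝ) * η (σ 0) (σ 1) * η' (σ 2) (σ 3)

/-- The `ℂ`-bilinear form `H(η,η') = ⟨η,η'⟩ + i η∧η'` on bivectors, where `i = −⋆`. -/
def HformC (η η' : Fin 4 → Fin 4 → ℝ) : ℂ :=
  (binner η η' : ℝ) + (bwedge η η' : ℝ) * Complex.I

/-- The quadratic form `δ(u) = dG(u) ∧ dG(u)` whose zero directions are the asymptotic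
directions. -/
def CNND.deltaQ (S : CNND) (p : Pt) (u : Pt) : ℝ :=
  bwedge (fderiv ℝ S.Gmap p u) (fderiv ℝ S.Gmap p u)

theorem mink_comm (v w : E4) : mink v w = mink w v := by
  simp only [mink]; ring

theorem mink_add_left (u v w : E4) : mink (u + v) w = mink u w + mink v w := by
  simp only [mink, Pi.add_apply]; ring

theorem mink_sub_left (u v w : E4) : mink (u - v) w = mink u w - mink v w := by
  simp only [mink, Pi.sub_apply]; ring

theorem mink_neg_left (u w : E4) : mink (-u) w = -mink u w := by
  simp only [mink, Pi.neg_apply]; ring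

theorem mink_smul_left (c : ℝ) (v w : E4) : mink (c • v) w = c * mink v w := by
  simp only [mink, Pi.smul_apply, smul_eq_mul]; ring

theorem fderiv_mink {f g : Pt → E4} {p : Pt} (hf : DifferentiableAt ℝ f p)
    (hg : DifferentiableAt ℝ g p) (v : Pt) :
    fderiv ℝ (fun q => mink (f q) (g q)) p v =
      mink (fderiv ℝ f p v) (g p) + mink (f p) (fderiv ℝ g p v) := by
  have hf' := hasFDerivAt_pi'.1 hf.hasFDerivAt
  have hg' := hasFDerivAt_pi'.1 hg.hasFDerivAt
  have h := (((((hf' 0).mul (hg' 0)).add ((hf' 1).mul (hg' 1))).add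
    ((hf' 2).mul (hg' 2))).sub ((hf' 3).mul (hg' 3)))
  have h' : HasFDerivAt (fun q => mink (f q) (g q)) _ p := h
  rw [h'.fderiv]
  simp [mink]
  ring

/-- Product rule for a differential applied to a coordinate vector field. -/
theorem fderiv_vecF {f : Pt → E4} {Y : Pt → Pt} {p : Pt}
    (hf : DifferentiableAt ℝ (fderiv ℝ f) p) (hY : DifferentiableAt ℝ Y p) (v : Pt) :
    fderiv ℝ (vecF f Y) p v =
      fderiv ℝ (fderiv ℝ f) p v (Y p) + fderiv ℝ f p (fderiv ℝ Y p v) := by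
  have h := hf.hasFDerivAt.clm_apply hY.hasFDerivAt
  have h' : HasFDerivAt (vecF f Y) _ p := h
  rw [h'.fderiv]
  simp [add_comm]

theorem contDiffOn_vecF {f : Pt → E4} {Y : Pt → Pt} {U : Set Pt} (hU : IsOpen U)
    (hf : ContDiffOn ℝ (⊤ : ℕ∞) f U) (hY : ContDiffOn ℝ (⊤ : ℕ∞) Y U) :
    ContDiffOn ℝ (⊤ : ℕ∞) (vecF f Y) U :=
  (hf.fderiv_of_isOpen hU (by simp)).clm_apply hY

theorem differentiableAt_of_contDiffOn {E : Type*} [NormedAddCommGroup E] [NormedSpace ℝ E]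
    {f : Pt → E} {U : Set Pt} (hU : IsOpen U) (hf : ContDiffOn ℝ (⊤ : ℕ∞) f U) {p : Pt}
    (hp : p ∈ U) : DifferentiableAt ℝ f p :=
  (hf.contDiffAt (hU.mem_nhds hp)).differentiableAt (by simp)

theorem fderiv_fderiv_comm {f : Pt → E4} {U : Set Pt} (hU : IsOpen U)
    (hf : ContDiffOn ℝ (⊤ : ℕ∞) f U) {p : Pt} (hp : p ∈ U) (u v : Pt) :
    fderiv ℝ (fderiv ℝ f) p u v = fderiv ℝ (fderiv ℝ f) p v u :=
  ((hf.contDiffAt (hU.mem_nhds hp)).isSymmSndFDerivAt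
    (by simpa using WithTop.coe_le_coe.2 (le_top : (2 : ℕ∞) ≤ ⊤))) u v

namespace CNND

variable (S : CNND) {p : Pt}

theorem isNormalV_Zperp (hp : p ∈ S.U) : isNormalV S.ψ p (S.Zperp p) :=
  S.hZTtangentpart p hp

theorem contDiffOn_Zperp : ContDiffOn ℝ (⊤ : ℕ∞) S.Zperp S.U :=
  contDiffOn_const.sub (contDiffOn_vecF S.hUopen S.hψ S.hZTsmooth)

theorem mink_vecF_ZT_self (hp : p ∈ S.U) :
    mink (vecF S.ψ S.ZT p) (vecF S.ψ S.ZT p) = 1 := by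
  have h1 := S.hZunit
  have h2 := S.hZperpNull p hp
  have h3 := S.hZTtangentpart p hp (S.ZT p)
  simp only [vecF, mink, Pi.sub_apply] at *
  linarith

theorem eq_zero_of_isTangentV_of_isNormalV (hp : p ∈ S.U) {v : E4} (ht : isTangentV S.ψ p v)
    (hn : isNormalV S.ψ p v) : v = 0 := by
  obtain ⟨w, rfl⟩ := ht
  by_contra hw
  have hw' : w ≠ 0 := fun h => hw (by simp [h])
  exact (S.hspacelike p hp w hw').ne' (hn w)

theorem differentiableAt_fderiv (hp : p ∈ S.U) : DifferentiableAt ℝ (fderiv ℝ S.ψ) p :=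
  differentiableAt_of_contDiffOn S.hUopen (S.hψ.fderiv_of_isOpen S.hUopen (by simp)) hp

theorem Dflat_Zperp (X : Pt → Pt) : Dflat X S.Zperp = -Dflat X (vecF S.ψ S.ZT) := by
  funext q
  change fderiv ℝ (fun q => S.Z - vecF S.ψ S.ZT q) q (X q) = _
  rw [fderiv_const_sub]
  rfl

/-- Paired with a normal vector, `∇̄_X Y` is the Hessian of the immersion. -/
theorem mink_Dflat_vecF (hp : p ∈ S.U) {X Y : Pt → Pt} (hY : DifferentiableAt ℝ Y p) {ν : E4}
    (hν : isNormalV S.ψ p ν) :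
    mink (Dflat X (vecF S.ψ Y) p) ν = mink (fderiv ℝ (fderiv ℝ S.ψ) p (X p) (Y p)) ν := by
  rw [Dflat, fderiv_vecF (S.differentiableAt_fderiv hp) hY, mink_add_left, mink_comm _ ν,
    mink_comm _ ν, hν, add_zero]

theorem mink_sff (hp : p ∈ S.U) {X Y : Pt → Pt} (hY : DifferentiableAt ℝ Y p) {ν : E4}
    (hν : isNormalV S.ψ p ν) :
    mink (sff S.ψ S.conn X Y p) ν = mink (fderiv ℝ (fderiv ℝ S.ψ) p (X p) (Y p)) ν := by
  rw [sff, mink_sub_left, S.mink_Dflat_vecF hp hY hν, vecF, mink_comm _ ν, mink_comm _ ν, hν,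
    sub_zero]

theorem nconn_Zperp (hp : p ∈ S.U) (X : Pt → Pt) :
    S.nconn X S.Zperp p = vecF S.Zperp X p + vecF S.ψ (S.conn X S.ZT) p := by
  have hV := differentiableAt_of_contDiffOn S.hUopen
    (contDiffOn_vecF S.hUopen S.hψ S.hZTsmooth) hp
  obtain ⟨hn, w, hw⟩ := S.hnconn X S.Zperp p hp (fun q hq => S.isNormalV_Zperp hq)
    (differentiableAt_of_contDiffOn S.hUopen S.contDiffOn_Zperp hp)
  have hB := S.hconn X S.ZT p hp hV
  have hD := congrFun (S.Dflat_Zperp X) p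
  have key : vecF S.Zperp X p + vecF S.ψ (S.conn X S.ZT) p = -sff S.ψ S.conn X S.ZT p := by
    change Dflat X S.Zperp p + _ = _
    rw [hD, sff, Pi.neg_apply]
    abel
  refine sub_eq_zero.1 (S.eq_zero_of_isTangentV_of_isNormalV hp ?_ ?_)
  · refine ⟨-w - S.conn X S.ZT p, ?_⟩
    rw [map_sub, map_neg, hw]
    simp only [Dflat, vecF]
    abel
  · intro u
    rw [key, mink_sub_left, mink_neg_left, hn u, hB u]
    simp

theorem mink_nconn (hp : p ∈ S.U) (X : Pt → Pt) {ν : Pt → E4}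
    (hν : ∀ q ∈ S.U, isNormalV S.ψ q (ν q)) (hd : DifferentiableAt ℝ ν p) {ξ : E4}
    (hξ : isNormalV S.ψ p ξ) : mink (S.nconn X ν p) ξ = mink (Dflat X ν p) ξ := by
  obtain ⟨-, w, hw⟩ := S.hnconn X ν p hp hν hd
  have h := hξ w
  rw [hw, mink_comm, mink_sub_left] at h
  linarith

/-- Expansion of a tangent vector orthogonal to `Z^⊤`. -/
theorem eq_smul_Wc (hp : p ∈ S.U) {u : Pt} {c : ℝ}
    (h1 : mink (fderiv ℝ S.ψ p u) (vecF S.ψ S.ZT p) = 0)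
    (h2 : mink (fderiv ℝ S.ψ p u) (vecF S.ψ S.Wc p) = c) : u = c • S.Wc p := by
  have hd := S.hWorient p hp
  set d := (S.ZT p).1 * (S.Wc p).2 - (S.ZT p).2 * (S.Wc p).1 with hd_def
  obtain ⟨s, t, rfl⟩ : ∃ s t : ℝ, u = s • S.ZT p + t • S.Wc p := by
    refine ⟨(u.1 * (S.Wc p).2 - u.2 * (S.Wc p).1) / d,
      (u.2 * (S.ZT p).1 - u.1 * (S.ZT p).2) / d, ?_⟩
    ext
    · simp only [Prod.fst_add, Prod.smul_fst, smul_eq_mul]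
      field_simp
      rw [hd_def]; ring
    · simp only [Prod.snd_add, Prod.smul_snd, smul_eq_mul]
      field_simp
      rw [hd_def]; ring
  have hZ := S.mink_vecF_ZT_self hp
  have hW := S.hWunit p hp
  have hZW := S.hWorth p hp
  have hWZ := hZW
  rw [mink_comm] at hWZ
  simp only [vecF, map_add, map_smul, mink_add_left, mink_smul_left] at *
  rw [hZ, hWZ] at h1
  rw [hZW, hW] at h2
  obtain rfl : s = 0 := by linarith
  obtain rfl : t = c := by linarith
  simp

/-- `∇_X Z^⊤ = ⟨B(X,W), Z^⊥⟩ W`. -/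
theorem conn_ZT (hp : p ∈ S.U) (X : Pt → Pt) :
    S.conn X S.ZT p = S.alphaF X p • S.Wc p := by
  have hVs := contDiffOn_vecF S.hUopen S.hψ S.hZTsmooth
  have hV := differentiableAt_of_contDiffOn S.hUopen hVs hp
  have hW := differentiableAt_of_contDiffOn S.hUopen
    (contDiffOn_vecF S.hUopen S.hψ S.hWsmooth) hp
  have hN := differentiableAt_of_contDiffOn S.hUopen S.contDiffOn_Zperp hp
  have hB := S.hconn X S.ZT p hp hV
  have hconn : ∀ u, mink (fderiv ℝ S.ψ p (S.conn X S.ZT p)) (fderiv ℝ S.ψ p u) =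
      mink (Dflat X (vecF S.ψ S.ZT) p) (fderiv ℝ S.ψ p u) := fun u => by
    have := hB u
    rw [sff, mink_sub_left] at this
    exact (sub_eq_zero.1 this).symm
  apply S.eq_smul_Wc hp
  · rw [vecF, hconn]
    have he : (fun q => mink (vecF S.ψ S.ZT q) (vecF S.ψ S.ZT q)) =ᶠ[nhds p] fun _ => 1 :=
      Filter.eventually_of_mem (S.hUopen.mem_nhds hp) fun q hq => S.mink_vecF_ZT_self hq
    have h := fderiv_mink hV hV (X p)
    rw [he.fderiv_eq, mink_comm (vecF S.ψ S.ZT p)] at h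
    simp only [fderiv_fun_const, Pi.zero_apply, zero_apply] at h
    change mink (fderiv ℝ (vecF S.ψ S.ZT) p (X p)) (vecF S.ψ S.ZT p) = 0
    linarith
  · rw [vecF, hconn]
    have he : (fun q => mink (S.Zperp q) (vecF S.ψ S.Wc q)) =ᶠ[nhds p] fun _ => 0 :=
      Filter.eventually_of_mem (S.hUopen.mem_nhds hp) fun q hq => S.isNormalV_Zperp hq _
    have h := fderiv_mink hN hW (X p)
    rw [he.fderiv_eq, mink_comm (S.Zperp p)] at h
    simp only [fderiv_fun_const, Pi.zero_apply, zero_apply] at h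
    have hD := congrFun (S.Dflat_Zperp X) p
    have hWd := differentiableAt_of_contDiffOn S.hUopen S.hWsmooth hp
    have hα : S.alphaF X p = mink (Dflat X (vecF S.ψ S.Wc) p) (S.Zperp p) := by
      rw [S.mink_Dflat_vecF hp hWd (S.isNormalV_Zperp hp), ← S.mink_sff hp hWd
        (S.isNormalV_Zperp hp)]
      rfl
    change fderiv ℝ S.Zperp p (X p) = -_ at hD
    rw [hD, mink_neg_left] at h
    rw [hα]
    change _ = mink (fderiv ℝ (vecF S.ψ S.Wc) p (X p)) (S.Zperp p)
    change 0 = -mink _ (fderiv ℝ S.ψ p (S.Wc p)) + _ at h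
    linarith

end CNND

/-- The normal curvature of `M` is given by `K_N = −a β(W)`. -/
theorem cnnd_normal_curvature_formula (S : CNND) :
    ∀ p ∈ S.U, S.KNfun p = -(S.afun p * S.beta p (S.Wc p)) := by
  intro p hp
  have hZd := differentiableAt_of_contDiffOn S.hUopen S.hZTsmooth hp
  have hWd := differentiableAt_of_contDiffOn S.hUopen S.hWsmooth hp
  have hNd := differentiableAt_of_contDiffOn S.hUopen S.contDiffOn_Zperp hp
  have hNdd := differentiableAt_of_contDiffOn S.hUopen
    (S.contDiffOn_Zperp.fderiv_of_isOpen S.hUopen (m := (⊤ : ℕ∞)) (by simp)) hp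
  have hWp := S.hWpNormal p hp
  have hNn := fun q (hq : q ∈ S.U) => S.isNormalV_Zperp hq
  -- The two second-order terms of the normal curvature.
  have hsecond : ∀ X Y : Pt → Pt, ContDiffOn ℝ (⊤ : ℕ∞) X S.U →
      mink (S.nconn Y (S.nconn X S.Zperp) p) (S.Wp p) =
        mink (fderiv ℝ (fderiv ℝ S.Zperp) p (Y p) (X p)) (S.Wp p) +
        mink (fderiv ℝ S.Zperp p (fderiv ℝ X p (Y p))) (S.Wp p) +
        mink (fderiv ℝ (fderiv ℝ S.ψ) p (Y p) (S.conn X S.ZT p)) (S.Wp p) := by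
    intro X Y hX
    have hXd := differentiableAt_of_contDiffOn S.hUopen hX hp
    have hc := S.hconnSmooth X S.ZT hX S.hZTsmooth
    have hν := S.hnconnSmooth X S.Zperp hX hNn S.contDiffOn_Zperp
    have hA := differentiableAt_of_contDiffOn S.hUopen
      (contDiffOn_vecF S.hUopen S.contDiffOn_Zperp hX) hp
    have hC := differentiableAt_of_contDiffOn S.hUopen
      (contDiffOn_vecF S.hUopen S.hψ hc) hp
    have he : S.nconn X S.Zperp =ᶠ[nhds p] vecF S.Zperp X + vecF S.ψ (S.conn X S.ZT) :=
      Filter.eventually_of_mem (S.hUopen.mem_nhds hp) fun q hq => S.nconn_Zperp hq X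
    rw [S.mink_nconn hp Y (fun q hq => (S.hnconn X S.Zperp q hq hNn
      (differentiableAt_of_contDiffOn S.hUopen S.contDiffOn_Zperp hq)).1)
      (differentiableAt_of_contDiffOn S.hUopen hν hp) hWp, Dflat, he.fderiv_eq,
      fderiv_add hA hC, add_apply, mink_add_left, fderiv_vecF hNdd hXd,
      mink_add_left, ← S.mink_Dflat_vecF hp
        (differentiableAt_of_contDiffOn S.hUopen hc hp) hWp]
    rfl
  have hBW := S.hbeta S.Wc p hp
  have hZW : mink (fderiv ℝ (fderiv ℝ S.ψ) p (S.ZT p) (S.Wc p)) (S.Wp p) =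
      S.beta p (S.Wc p) := by
    rw [fderiv_fderiv_comm S.hUopen S.hψ hp, ← S.mink_sff hp hZd hWp, hBW, mink_smul_left,
      S.hWpPair p hp, mul_one]
  have hαZ : S.alphaF S.ZT p = 0 := by
    have hn := hNn p hp
    rw [CNND.alphaF, CNND.B, S.mink_sff hp hWd hn, fderiv_fderiv_comm S.hUopen S.hψ hp,
      ← S.mink_sff hp hZd hn, hBW, mink_smul_left]
    exact mul_eq_zero_of_right _ (S.hZperpNull p hp)
  rw [CNND.KNfun, curvRperp, mink_add_left, mink_sub_left, hsecond _ _ S.hZTsmooth,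
    hsecond _ _ S.hWsmooth, S.mink_nconn hp _ hNn hNd hWp, S.conn_ZT hp, S.conn_ZT hp, hαZ,
    Dflat, lieB, map_sub, mink_sub_left, map_smul, map_smul, mink_smul_left, mink_smul_left, hZW,
    fderiv_fderiv_comm S.hUopen S.contDiffOn_Zperp hp (S.Wc p)]
  change _ = -(S.alphaF S.Wc p * _)
  ring

end
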